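/- arXiv:1310.0141 — 8 statements merged into one kernel-verified Lean document; each statement's English description precedes it below -/
import Mathlib

section
/- Let n ≥ 1 and let m < 2^n be a contiguous mask with tail t = tail(m) and head h = head(m) (so m = 2^h − 2^t), and let p be a pattern for m. Then for every natural number x, x &&& m = p if and only if p ≤ x mod 2^h and x mod 2^h < p + 2^t. (Hence within each aligned block of 2^h consecutive integers, the locus is a single interval of length 2^t.) -/
theorem Nat.and_two_pow_sub_two_pow {t h : ℕ} (hth : t ≤ h) (x : ℕ) :
    x &&& (2 ^ h - 2 ^ t) = 2 ^ t * (x % 2 ^ h / 2 ^ t) := by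
  obtain ⟨k, rfl⟩ := Nat.exists_eq_add_of_le hth
  have h_mask : 2 ^ (t + k) - 2 ^ t = 2 ^ t * (2 ^ k - 1) := by
    rw [pow_add, Nat.mul_sub, mul_one]
  rw [h_mask]
  apply Nat.eq_of_testBit_eq
  intro i
  rw [Nat.testBit_and, Nat.testBit_two_pow_mul, Nat.testBit_two_pow_mul,
    Nat.testBit_two_pow_sub_one, Nat.testBit_div_two_pow, Nat.testBit_mod_two_pow]
  by_cases hi : t ≤ i
  · have h_lt : i - t < k ↔ i < t + k := by omega
    simp [hi, h_lt, Bool.and_comm]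
  · simp [hi]

/-- For a contiguous mask `m = 2^h - 2^t` (tail `t`, head `h`), a key `x` matches the
pattern `p` iff `x mod 2^h` lies in the interval `[p, p + 2^t)`. -/
theorem point_psp_contiguous_mask (n m t h p : ℕ) (hn : 1 ≤ n) (hth : t < h)
    (hmask : m = 2 ^ h - 2 ^ t) (hm : m < 2 ^ n) (hp : p &&& m = p) :
    ∀ x : ℕ, x &&& m = p ↔ (p ≤ x % 2 ^ h ∧ x % 2 ^ h < p + 2 ^ t) := by
  intro x
  have hpos : 0 < 2 ^ t := by positivity
  subst hmask
  rw [Nat.and_two_pow_sub_two_pow hth.le] at hp ⊢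
  generalize p % 2 ^ h / 2 ^ t = q at hp
  subst hp
  rw [Nat.mul_right_inj hpos.ne', Nat.div_eq_iff hpos, mul_comm q]
  omega
end

section
/- Let n ≥ 1, let m < 2^n be a nonzero mask with popcount d and t = tail(m), and let p be a pattern for m. Let C = {x : x < 2^n ∧ x &&& m = p ∧ x mod 2^t = 0}. Then card C = 2^(n−d−t), and the point-PSP locus L(m,p) is the disjoint union over y ∈ C of the intervals [y, y + 2^t). (This is the cluster structure of Proposition 1: the locus consists of 2^(n−d−tail(m)) intervals of length 2^(tail(m)) each.) -/
theorem Nat.exists_testBit_iff_mem (S : Finset ℕ) : ∃ x : ℕ, ∀ i, x.testBit i ↔ i ∈ S := by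
  induction S using Finset.induction_on with
  | empty => exact ⟨0, by simp⟩
  | insert a S _ ih =>
    obtain ⟨x, hx⟩ := ih
    refine ⟨x ||| 2 ^ a, fun i => ?_⟩
    rw [Nat.testBit_or, Nat.testBit_two_pow, Bool.or_eq_true, hx, decide_eq_true_iff,
      Finset.mem_insert, or_comm, eq_comm (a := a)]

/-- There are `2 ^ #F` natural numbers whose bits agree with those of `p` outside `F`. -/
theorem Nat.ncard_testBit_eq_off (F : Finset ℕ) (p : ℕ) :
    Set.ncard {x : ℕ | ∀ i ∉ F, x.testBit i = p.testBit i} = 2 ^ F.card := by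
  rw [← Finset.card_powerset, ← Set.ncard_coe_finset]
  refine Set.ncard_congr (fun x _ => F.filter (fun i => x.testBit i)) ?_ ?_ ?_
  · intro x _
    exact Finset.mem_coe.2 (Finset.mem_powerset.2 (Finset.filter_subset _ _))
  · intro x y hx hy hxy
    refine Nat.eq_of_testBit_eq fun i => ?_
    by_cases hi : i ∈ F
    · have h := Finset.ext_iff.1 hxy i
      simp only [Finset.mem_filter, hi, true_and] at h
      exact Bool.eq_iff_iff.2 h
    · rw [hx i hi, hy i hi]
  · intro S hS
    have hSF : S ⊆ F := by simpa using hS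
    obtain ⟨a, ha⟩ := Nat.exists_testBit_iff_mem F
    obtain ⟨s, hs⟩ := Nat.exists_testBit_iff_mem S
    refine ⟨p ^^^ ((p ^^^ s) &&& a), fun i hi => ?_, ?_⟩
    · have h : a.testBit i = false := Bool.eq_false_iff.2 (mt (ha i).1 hi)
      simp [h]
    · ext i
      rw [Finset.mem_filter]
      constructor
      · rintro ⟨hi, h⟩
        have h' : a.testBit i = true := (ha i).2 hi
        rw [← hs]
        simpa [h'] using h
      · intro hi
        have h' : a.testBit i = true := (ha i).2 (hSF hi)
        have h'' : s.testBit i = true := (hs i).2 hi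
        exact ⟨hSF hi, by simp [h', h'']⟩

theorem Nat.testBit_eq_of_div_two_pow_eq {x y t i : ℕ} (h : x / 2 ^ t = y / 2 ^ t)
    (hi : t ≤ i) : x.testBit i = y.testBit i := by
  obtain ⟨j, rfl⟩ := Nat.exists_eq_add_of_le' hi
  rw [← Nat.testBit_div_two_pow, h, Nat.testBit_div_two_pow]

theorem Nat.land_eq_land_of_div_two_pow_eq {x y t m : ℕ} (h : x / 2 ^ t = y / 2 ^ t)
    (hm : ∀ i < t, ¬ m.testBit i) : x &&& m = y &&& m := by
  refine Nat.eq_of_testBit_eq fun i => ?_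
  rw [Nat.testBit_and, Nat.testBit_and]
  rcases lt_or_ge i t with hi | hi
  · simp [hm i hi]
  · rw [Nat.testBit_eq_of_div_two_pow_eq h hi]

theorem Nat.lt_two_pow_of_div_two_pow_eq {x y t n : ℕ} (h : x / 2 ^ t = y / 2 ^ t)
    (htn : t ≤ n) (hy : y < 2 ^ n) : x < 2 ^ n := by
  refine Nat.lt_pow_two_of_testBit x fun i hi => ?_
  rw [Nat.testBit_eq_of_div_two_pow_eq h (htn.trans hi)]
  exact Nat.testBit_lt_two_pow (hy.trans_le (Nat.pow_le_pow_right two_pos hi))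

theorem Nat.div_eq_div_of_mem_Ico {x y k : ℕ} (hk : 0 < k) (hy : y % k = 0)
    (hx : x ∈ Set.Ico y (y + k)) : x / k = y / k := by
  obtain ⟨c, rfl⟩ := Nat.dvd_of_mod_eq_zero hy
  rw [Nat.mul_div_cancel_left c hk]
  exact Nat.div_eq_of_lt_le (by rw [mul_comm]; exact hx.1)
    (by rw [Nat.succ_mul, mul_comm]; exact hx.2)

/-- Cluster structure of the point-PSP locus: the set `C` of `2^t`-aligned matching keys
has cardinality `2^(n-d-t)` and the locus is the disjoint union of the intervals
`[y, y + 2^t)` over `y ∈ C`, where `t = tail(m)` and `d = popcount(m)`. -/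
theorem point_psp_cluster_structure (n m t p d : ℕ) (hn : 1 ≤ n) (hm : m < 2 ^ n)
    (hm0 : m ≠ 0)
    (hd : d = ((Finset.range n).filter (fun i => m.testBit i)).card)
    (ht : m.testBit t ∧ ∀ i < t, ¬ m.testBit i) (hp : p &&& m = p) :
    Set.ncard {x : ℕ | x < 2 ^ n ∧ x &&& m = p ∧ x % 2 ^ t = 0} = 2 ^ (n - d - t) ∧
    {x : ℕ | x < 2 ^ n ∧ x &&& m = p} =
      (⋃ y ∈ {x : ℕ | x < 2 ^ n ∧ x &&& m = p ∧ x % 2 ^ t = 0},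
        Set.Ico y (y + 2 ^ t)) ∧
    Set.PairwiseDisjoint {x : ℕ | x < 2 ^ n ∧ x &&& m = p ∧ x % 2 ^ t = 0}
      (fun y => Set.Ico y (y + 2 ^ t)) := by
  obtain ⟨htm, hlow⟩ := ht
  have hpos : 0 < 2 ^ t := Nat.two_pow_pos t
  have htn : t < n := by
    by_contra! h
    simp [Nat.testBit_lt_two_pow (hm.trans_le (Nat.pow_le_pow_right two_pos h))] at htm
  have hpbit : ∀ i, p.testBit i = (p.testBit i && m.testBit i) := fun i => by
    rw [← Nat.testBit_and, hp]
  refine ⟨?_, ?_, ?_⟩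
  · set F := (Finset.range n).filter (fun i => t ≤ i ∧ ¬ m.testBit i) with hF
    have hcard : F.card = n - d - t := by
      have h₁ := Finset.card_filter_add_card_filter_not (s := Finset.range n)
        (fun i => m.testBit i = true)
      have h₂ : (Finset.range n).filter (fun i => ¬ m.testBit i) = F ∪ Finset.range t := by
        ext i
        simp only [hF, Finset.mem_filter, Finset.mem_range, Finset.mem_union]
        have := hlow i
        grind
      have h₃ : Disjoint F (Finset.range t) := by
        rw [Finset.disjoint_left]
        intro i hi
        simp only [hF, Finset.mem_filter] at hi
        simpa using hi.2.1
      rw [h₂, Finset.card_union_of_disjoint h₃, Finset.card_range, Finset.card_range, ← hd] at h₁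
      omega
    rw [← hcard, ← Nat.ncard_testBit_eq_off F p]
    congr 1
    ext x
    simp only [Set.mem_ofPred_eq]
    constructor
    · rintro ⟨hx, hxm, hxt⟩ i hi
      rcases lt_or_ge i t with hit | hit
      · rw [hpbit i]
        have h := congrArg (fun z => z.testBit i) hxt
        simp only [Nat.testBit_mod_two_pow, hit, Nat.zero_testBit] at h
        simpa [hlow i hit] using h
      rcases lt_or_ge i n with hin | hin
      · have hmi : m.testBit i = true := by
          by_contra h
          exact hi (by simp [hF, hin, hit, h])
        rw [← hxm, Nat.testBit_and, hmi, Bool.and_true]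
      · have h := Nat.pow_le_pow_right two_pos hin
        rw [Nat.testBit_lt_two_pow (hx.trans_le h), hpbit i,
          Nat.testBit_lt_two_pow (hm.trans_le h), Bool.and_false]
    · intro h
      refine ⟨Nat.lt_pow_two_of_testBit x fun i hi => ?_, Nat.eq_of_testBit_eq fun i => ?_,
        Nat.eq_of_testBit_eq fun i => ?_⟩
      · rw [h i (by simp [hF, hi]), hpbit i,
          Nat.testBit_lt_two_pow (hm.trans_le (Nat.pow_le_pow_right two_pos hi)), Bool.and_false]
      · rw [Nat.testBit_and]
        by_cases hmi : m.testBit i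
        · rw [h i (by simp [hF, hmi]), ← hpbit i]
        · rw [hpbit i]
          simp [hmi]
      · rw [Nat.testBit_mod_two_pow, Nat.zero_testBit]
        by_cases hit : i < t
        · rw [h i (by simp [hF, hit]), hpbit i]
          simp [hlow i hit]
        · simp [hit]
  · ext x
    simp only [Set.mem_ofPred_eq, Set.mem_iUnion, exists_prop]
    constructor
    · rintro ⟨hx, hxm⟩
      have hdiv : 2 ^ t * (x / 2 ^ t) / 2 ^ t = x / 2 ^ t := Nat.mul_div_cancel_left _ hpos
      refine ⟨2 ^ t * (x / 2 ^ t), ⟨Nat.lt_two_pow_of_div_two_pow_eq hdiv htn.le hx,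
        (Nat.land_eq_land_of_div_two_pow_eq hdiv hlow).trans hxm, Nat.mul_mod_right _ _⟩,
        Nat.mul_div_le _ _, Nat.lt_mul_div_succ x hpos⟩
    · rintro ⟨y, ⟨hy, hym, hyt⟩, hxy⟩
      have hdiv := Nat.div_eq_div_of_mem_Ico hpos hyt hxy
      exact ⟨Nat.lt_two_pow_of_div_two_pow_eq hdiv htn.le hy,
        (Nat.land_eq_land_of_div_two_pow_eq hdiv hlow).trans hym⟩
  · rintro y ⟨_, _, hy⟩ z ⟨_, _, hz⟩ hyz
    refine Set.disjoint_left.2 fun x hxy hxz => hyz ?_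
    have h : y / 2 ^ t = z / 2 ^ t :=
      (Nat.div_eq_div_of_mem_Ico hpos hy hxy).symm.trans (Nat.div_eq_div_of_mem_Ico hpos hz hxz)
    rw [← Nat.div_add_mod y (2 ^ t), ← Nat.div_add_mod z (2 ^ t), h, hy, hz]
end

section
/- Let n ≥ 1, let m < 2^n be a mask with popcount d, and let p be a pattern for m. Then the number of integers x with p ≤ x ≤ p + (2^n − 1 − m) and x &&& m ≠ p equals 2^n − m − 2^(n−d). (This is the total length of the lacunae of the point PSP: the spread 2^n − m minus the locus cardinality 2^(n−d).) -/
theorem Nat.land_add_lor (x y : ℕ) : (x &&& y) + (x ||| y) = x + y := by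
  induction x using Nat.strong_induction_on generalizing y with
  | _ x ih =>
    rcases Nat.eq_zero_or_pos x with rfl | hx
    · simp
    · have h := ih (x / 2) (by omega) (y / 2)
      rw [← Nat.and_div_two, ← Nat.or_div_two] at h
      have ha : (x &&& y) % 2 = 1 ↔ x % 2 = 1 ∧ y % 2 = 1 := Nat.and_mod_two_eq_one
      have ho : (x ||| y) % 2 = 1 ↔ x % 2 = 1 ∨ y % 2 = 1 := Nat.or_mod_two_eq_one
      omega

/-- The locus of a point PSP: fixing the bits of `p` on the mask `m` leaves one free bit for every
position outside the mask. -/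
theorem card_filter_land_eq {n m p : ℕ} (hm : m < 2 ^ n) (hp : p &&& m = p) :
    ((Finset.range (2 ^ n)).filter (fun x => x &&& m = p)).card =
      2 ^ ((Finset.range n).filter (fun i => ¬ m.testBit i)).card := by
  have bit_land : ∀ x : ℕ, x &&& m = p ↔ ∀ i, (x.testBit i && m.testBit i) = p.testBit i :=
    fun x => ⟨fun h i => by rw [← h, Nat.testBit_and],
      fun h => Nat.eq_of_testBit_eq fun i => by rw [Nat.testBit_and, h]⟩
  rw [← Finset.card_powerset]
  refine Finset.card_bij
    (fun x _ => (Finset.range n).filter (fun i => ¬ m.testBit i ∧ x.testBit i)) ?_ ?_ ?_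
  · intro x _
    rw [Finset.mem_powerset]
    intro i
    simp +contextual
  · intro x hx y hy hxy
    simp only [Finset.mem_filter, Finset.mem_range, bit_land] at hx hy
    refine Nat.eq_of_testBit_eq fun i => ?_
    by_cases hi : i < n
    · have h := Finset.ext_iff.mp hxy i
      have hxi := hx.2 i
      have hyi := hy.2 i
      simp only [Finset.mem_filter, Finset.mem_range, hi, true_and] at h
      cases hmi : m.testBit i <;> simp_all
    · have hpow : 2 ^ n ≤ 2 ^ i := Nat.pow_le_pow_right two_pos (not_lt.mp hi)
      rw [Nat.testBit_lt_two_pow (hx.1.trans_le hpow), Nat.testBit_lt_two_pow (hy.1.trans_le hpow)]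
  · intro s hs
    rw [Finset.mem_powerset] at hs
    have hs' : ∀ i ∈ s, i < n ∧ m.testBit i = false := fun i hi => by simpa using hs hi
    have hpm := (bit_land p).mp hp
    refine ⟨Nat.ofBits (fun i : Fin n => p.testBit i || decide ((i : ℕ) ∈ s)), ?_, ?_⟩
    · simp only [Finset.mem_filter, Finset.mem_range, bit_land]
      refine ⟨Nat.ofBits_lt_two_pow _, fun i => ?_⟩
      have hpi := hpm i
      by_cases hi : i < n
      · rw [Nat.testBit_ofBits_lt _ _ hi]
        by_cases his : i ∈ s
        · simp_all
        · simpa [his] using hpi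
      · rw [Nat.testBit_lt_two_pow (hm.trans_le (Nat.pow_le_pow_right two_pos (not_lt.mp hi)))]
          at hpi ⊢
        simpa using hpi
    · ext i
      have hpi := hpm i
      by_cases hi : i < n
      · simp only [Finset.mem_filter, Finset.mem_range, Nat.testBit_ofBits_lt _ _ hi]
        by_cases his : i ∈ s
        · simp [his, hs' i his]
        · cases hmi : m.testBit i <;> simp_all
      · have his : i ∉ s := fun h => hi (hs' i h).1
        simp [hi, his]

/-- The total length of the lacunae of a point PSP: the number of non-matching keys in the
bounding interval `[p, p + (2^n - 1 - m)]` equals the spread `2^n - m` minus the locus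
cardinality `2^(n-d)`. -/
theorem point_psp_total_lacunae_length (n m p d : ℕ) (hn : 1 ≤ n) (hm : m < 2 ^ n)
    (hd : d = ((Finset.range n).filter (fun i => m.testBit i)).card)
    (hp : p &&& m = p) :
    Set.ncard {x : ℕ | p ≤ x ∧ x ≤ p + (2 ^ n - 1 - m) ∧ x &&& m ≠ p} =
      2 ^ n - m - 2 ^ (n - d) := by
  have hpm : p ≤ m := hp ▸ Nat.and_le_right
  have hfree : n - d = ((Finset.range n).filter (fun i => ¬ m.testBit i)).card := by
    have h := Finset.card_filter_add_card_filter_not (s := Finset.range n)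
      (fun i => m.testBit i = true)
    rw [Finset.card_range] at h
    omega
  have hset : {x : ℕ | p ≤ x ∧ x ≤ p + (2 ^ n - 1 - m) ∧ x &&& m ≠ p} =
      ↑((Finset.Icc p (p + (2 ^ n - 1 - m))) \
        (Finset.range (2 ^ n)).filter (fun x => x &&& m = p)) := by
    ext x
    simp only [Set.mem_ofPred_eq, Finset.coe_sdiff, Set.mem_sdiff, Finset.mem_coe, Finset.mem_Icc,
      Finset.mem_filter, Finset.mem_range, and_assoc]
    refine and_congr_right fun _ => and_congr_right fun hx => ?_
    have : x < 2 ^ n := by omega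
    simp [this]
  have hsub : (Finset.range (2 ^ n)).filter (fun x => x &&& m = p) ⊆
      Finset.Icc p (p + (2 ^ n - 1 - m)) := by
    intro x hx
    rw [Finset.mem_filter, Finset.mem_range] at hx
    obtain ⟨hx, rfl⟩ := hx
    have hadd := Nat.land_add_lor x m
    have hor := Nat.or_lt_two_pow hx hm
    exact Finset.mem_Icc.mpr ⟨Nat.and_le_left, by omega⟩
  rw [hset, Set.ncard_coe_finset, Finset.card_sdiff_of_subset hsub, card_filter_land_eq hm hp,
    ← hfree, Nat.card_Icc]
  congr 1
  omega
end

section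
/- Let n ≥ 1, let m < 2^n be a nonzero mask with canonical partition m_1, …, m_k (heads h_i, tails t_i, listed from most significant to least), and let p be a pattern for m. Define Σ_j = Σ_{i=j}^{k} (2^{h_i} − 2^{t_i}). If x < y are elements of the point-PSP locus L(m,p) with no element of L(m,p) strictly between them and y > x + 1, then y − x − 1 = Σ_j for some j ∈ {1, …, k}. (Individual lacunae lengths of the point PSP are exactly among the partial sums Σ_j.) -/
/-- Two naturals have the same conjunction with a mask iff this holds for the lowest bits
and for the remaining bits separately. -/
theorem Nat.and_eq_and_iff_div_two_mod_two (x y m : ℕ) :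
    x &&& m = y &&& m ↔ x / 2 &&& m / 2 = y / 2 &&& m / 2 ∧ (m % 2 = 1 → x % 2 = y % 2) := by
  have hx : (x &&& m) % 2 = 1 ↔ x % 2 = 1 ∧ m % 2 = 1 := Nat.and_mod_two_eq_one
  have hy : (y &&& m) % 2 = 1 ↔ y % 2 = 1 ∧ m % 2 = 1 := Nat.and_mod_two_eq_one
  rw [← Nat.and_div_two, ← Nat.and_div_two]
  omega

/-- The gap between consecutive naturals with the same conjunction with `m` is one more than
the truncation of `m` below one of its zero bits. -/
theorem Nat.exists_sub_eq_mod_two_pow_of_and_eq (y : ℕ) : ∀ m x : ℕ, x < y →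
    x &&& m = y &&& m → (∀ z, x < z → z < y → z &&& m ≠ y &&& m) →
    ∃ d, m / 2 ^ d % 2 = 0 ∧ y - x = m % 2 ^ d + 1 := by
  induction y using Nat.strong_induction_on with
  | _ y ih =>
    intro m x hxy hand hgap
    have lift (c : ℕ) (hc : c < 2) (hcm : m % 2 = 1 → c = y % 2) (hlt : x / 2 < y / 2) :
        ∃ d, m / 2 / 2 ^ d % 2 = 0 ∧ y / 2 - x / 2 = m / 2 % 2 ^ d + 1 := by
      rw [Nat.and_eq_and_iff_div_two_mod_two] at hand
      refine ih (y / 2) (by omega) (m / 2) (x / 2) hlt hand.1 fun z hxz hzy hz ↦ ?_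
      refine hgap (2 * z + c) (by omega) (by omega) ?_
      rw [Nat.and_eq_and_iff_div_two_mod_two]
      have : (2 * z + c) / 2 = z := by omega
      exact ⟨by rwa [this], by omega⟩
    have finish (h : ∃ d, m / 2 / 2 ^ d % 2 = 0 ∧ y / 2 - x / 2 = m / 2 % 2 ^ d + 1)
        (hpar : m % 2 + 1 + x % 2 = 2 + y % 2) :
        ∃ d, m / 2 ^ d % 2 = 0 ∧ y - x = m % 2 ^ d + 1 := by
      obtain ⟨d, hd, hsub⟩ := h
      have hmod : m % 2 ^ (d + 1) = m % 2 + 2 * (m / 2 % 2 ^ d) := by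
        rw [pow_succ', Nat.mod_mul]
      refine ⟨d + 1, ?_, by omega⟩
      rwa [pow_succ', ← Nat.div_div_eq_div_mul]
    have hsplit := (Nat.and_eq_and_iff_div_two_mod_two x y m).1 hand
    rcases Nat.mod_two_eq_zero_or_one m with hm | hm
    · have flip (z : ℕ) (hz : z / 2 &&& m / 2 = y / 2 &&& m / 2) : z &&& m = y &&& m :=
        (Nat.and_eq_and_iff_div_two_mod_two z y m).2 ⟨hz, by omega⟩
      rcases Nat.mod_two_eq_zero_or_one x with hx | hx
      · have hdiv : (x + 1) / 2 = x / 2 := by omega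
        have hy : ¬ x + 1 < y := fun hlt ↦
          hgap (x + 1) (by omega) hlt (flip _ (hdiv ▸ hsplit.1))
        exact ⟨0, by simpa using hm, by rw [pow_zero, Nat.mod_one]; omega⟩
      · have hy : y % 2 = 0 := by
          by_contra hy
          have hdiv : (y - 1) / 2 = y / 2 := by omega
          exact hgap (y - 1) (by omega) (by omega) (flip _ (by rw [hdiv]))
        exact finish (lift 0 (by omega) (by omega) (by omega)) (by omega)
    · have hpar := hsplit.2 hm
      exact finish (lift (y % 2) (by omega) (by omega) (by omega)) (by omega)

/-- A sum of separated runs of consecutive bits, listed from the most significant one, stays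
below `2 ^ N` for every `N` bounding the first head. -/
theorem sum_runs_lt_two_pow (k : ℕ) : ∀ (h t : Fin k → ℕ) (N : ℕ), (∀ i, t i < h i) →
    (∀ i : Fin k, ∀ hi : i.val + 1 < k, h ⟨i.val + 1, hi⟩ < t i) →
    (∀ hk : 0 < k, h ⟨0, hk⟩ ≤ N) → ∑ i, (2 ^ h i - 2 ^ t i) < 2 ^ N := by
  induction k with
  | zero => intro h t N _ _ _; simp
  | succ k ih =>
    intro h t N hth hdesc hN
    rw [Fin.sum_univ_succ]
    have htail := ih (fun i ↦ h i.succ) (fun i ↦ t i.succ) (t 0) (fun i ↦ hth _)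
      (fun i hi ↦ hdesc i.succ (by simpa using hi)) (fun hk ↦ (hdesc 0 (by simpa using hk)).le)
    have h1 : 2 ^ t 0 < 2 ^ h 0 := Nat.pow_lt_pow_right (by omega) (hth 0)
    have h2 : 2 ^ h 0 ≤ 2 ^ N := Nat.pow_le_pow_right (by omega) (hN (by omega))
    omega

/-- Truncating a sum of separated runs of consecutive bits below one of its zero bits leaves
either nothing or the sum of a final segment of the runs. -/
theorem sum_runs_mod_two_pow (k d : ℕ) : ∀ h t : Fin k → ℕ, (∀ i, t i < h i) →
    (∀ i : Fin k, ∀ hi : i.val + 1 < k, h ⟨i.val + 1, hi⟩ < t i) →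
    (∑ i, (2 ^ h i - 2 ^ t i)) / 2 ^ d % 2 = 0 →
    (∑ i, (2 ^ h i - 2 ^ t i)) % 2 ^ d = 0 ∨
      ∃ j, (∑ i, (2 ^ h i - 2 ^ t i)) % 2 ^ d = ∑ i ∈ Finset.Ici j, (2 ^ h i - 2 ^ t i) := by
  induction k with
  | zero => intro h t _ _ _; simp
  | succ k ih =>
    intro h t hth hdesc hbit
    have hth' : ∀ i : Fin k, t i.succ < h i.succ := fun i ↦ hth _
    have hdesc' : ∀ i : Fin k, ∀ hi : i.val + 1 < k, h (Fin.succ ⟨i.val + 1, hi⟩) < t i.succ :=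
      fun i hi ↦ hdesc i.succ (by simpa using hi)
    rcases le_or_gt (h 0) d with hd | hd
    · refine Or.inr ⟨0, ?_⟩
      rw [Nat.mod_eq_of_lt (sum_runs_lt_two_pow _ h t d hth hdesc fun _ ↦ hd)]
      congr 1
      ext i
      simp
    have htail := sum_runs_lt_two_pow k (fun i ↦ h i.succ) (fun i ↦ t i.succ) (t 0) hth' hdesc'
      (fun hk ↦ (hdesc 0 (by simpa using hk)).le)
    have ih := ih (fun i ↦ h i.succ) (fun i ↦ t i.succ) hth' hdesc'
    rw [Fin.sum_univ_succ] at hbit ⊢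
    set s := ∑ i : Fin k, (2 ^ h i.succ - 2 ^ t i.succ)
    obtain ⟨a, ha⟩ := Nat.exists_eq_add_of_lt hd
    have hpow : 2 ^ h 0 = 2 ^ d * (2 * 2 ^ a) := by rw [ha]; ring
    rcases le_or_gt (t 0) d with ht | ht
    · exfalso
      have hle : 2 ^ t 0 ≤ 2 ^ d := Nat.pow_le_pow_right (by omega) ht
      obtain ⟨b, hb⟩ : ∃ b, 2 ^ a = b + 1 := ⟨2 ^ a - 1, by have := Nat.two_pow_pos a; omega⟩
      have hsplit : 2 ^ h 0 - 2 ^ t 0 + s = (2 ^ d - 2 ^ t 0 + s) + 2 ^ d * (2 * b + 1) := by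
        have : 2 ^ h 0 = 2 ^ d + 2 ^ d * (2 * b + 1) := by rw [hpow, hb]; ring
        omega
      rw [hsplit, Nat.add_mul_div_left _ _ (Nat.two_pow_pos d),
        Nat.div_eq_of_lt (by omega)] at hbit
      omega
    · obtain ⟨b, hb⟩ := Nat.exists_eq_add_of_lt ht
      have hpow' : 2 ^ t 0 = 2 ^ d * (2 * 2 ^ b) := by rw [hb]; ring
      have hrun : 2 ^ h 0 - 2 ^ t 0 + s = s + 2 ^ d * (2 * (2 ^ a - 2 ^ b)) := by
        rw [hpow, hpow', ← Nat.mul_sub, ← Nat.mul_sub, add_comm]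
      rw [hrun, Nat.add_mul_div_left _ _ (Nat.two_pow_pos d), Nat.add_mul_mod_self_left] at hbit
      rw [hrun, Nat.add_mul_mod_self_left]
      refine (ih hbit).imp_right fun ⟨j, hj⟩ ↦ ⟨j.succ, hj.trans ?_⟩
      rw [← Fin.map_succEmb_Ici, Finset.sum_map]
      rfl

/-- Individual lacunae lengths of the point PSP are among the partial sums
`Σ_j = Σ_{i ≥ j} (2^{h_i} - 2^{t_i})` over the canonical partition of the mask,
listed from most significant (index `0`) to least significant. -/
theorem point_psp_lacunae_lengths (n m p k : ℕ) (h t : Fin k → ℕ)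
    (hn : 1 ≤ n) (hm : m < 2 ^ n) (hm0 : m ≠ 0) (hk : 1 ≤ k)
    (hth : ∀ i, t i < h i)
    (hdesc : ∀ i : Fin k, ∀ hi : i.val + 1 < k, h ⟨i.val + 1, hi⟩ < t i)
    (hsum : m = ∑ i, (2 ^ h i - 2 ^ t i))
    (hp : p &&& m = p) :
    ∀ x y : ℕ, x ∈ {z : ℕ | z < 2 ^ n ∧ z &&& m = p} →
      y ∈ {z : ℕ | z < 2 ^ n ∧ z &&& m = p} → x < y →
      (∀ z, x < z → z < y → z ∉ {z : ℕ | z < 2 ^ n ∧ z &&& m = p}) →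
      x + 1 < y →
      ∃ j : Fin k, y - x - 1 = ∑ i ∈ Finset.Ici j, (2 ^ h i - 2 ^ t i) := by
  rintro x y ⟨_, hx⟩ ⟨hyn, hy⟩ hxy hgap hlac
  obtain ⟨d, hd, hsub⟩ := Nat.exists_sub_eq_mod_two_pow_of_and_eq y m x hxy (hx.trans hy.symm)
    fun z hxz hzy hz ↦ hgap z hxz hzy ⟨hzy.trans hyn, hz.trans hy⟩
  have hlen : y - x - 1 = m % 2 ^ d := by omega
  rw [hsum] at hd
  rcases sum_runs_mod_two_pow k d h t hth hdesc hd with hzero | ⟨j, hj⟩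
  · rw [← hsum] at hzero
    omega
  · rw [← hsum] at hj
    exact ⟨j, hlen.trans hj⟩
end

section
/- Let n ≥ 1, let m < 2^n be a mask and p a pattern for m, and let x < 2^n satisfy x &&& m ≠ p. Let j be the most significant bit position at which x &&& m and p differ, and suppose bit j of p is 1 (so bit j of x is 0; a negative mismatch). Then the set {y : y > x ∧ y &&& m = p} is nonempty, its minimum is y* = 2^{j+1}·⌊x/2^{j+1}⌋ + 2^j + (p mod 2^j), and y* < 2^n. (Correctness of the point matcher's Hint operation for negative mismatches.) -/
/-- The bits of the number whose bits above `j` are those of `x`, whose bit `j` is `1`, and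
whose bits below `j` are those of `p`. -/
theorem testBit_splice (x p j i : ℕ) :
    (2 ^ (j + 1) * (x / 2 ^ (j + 1)) + 2 ^ j + p % 2 ^ j).testBit i =
      if i < j then p.testBit i else if i = j then true else x.testBit i := by
  have hlt : p % 2 ^ j < 2 ^ j := Nat.mod_lt _ (by positivity)
  have heq : 2 ^ (j + 1) * (x / 2 ^ (j + 1)) + 2 ^ j + p % 2 ^ j =
      2 ^ j * (2 * (x / 2 ^ (j + 1)) + 1) + p % 2 ^ j := by ring
  rw [heq, Nat.testBit_two_pow_mul_add _ hlt]
  split_ifs with h1 h2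
  · simp [Nat.testBit_mod_two_pow, h1]
  · subst h2
    simp
  · obtain ⟨k, rfl⟩ : ∃ k, i = j + 1 + k := ⟨i - (j + 1), by omega⟩
    have hk : j + 1 + k - j = k + 1 := by omega
    rw [hk, Nat.testBit_succ]
    have hdiv : (2 * (x / 2 ^ (j + 1)) + 1) / 2 = x / 2 ^ (j + 1) := by omega
    rw [hdiv, Nat.testBit_div_two_pow, Nat.add_comm k]

/-- Correctness of the point matcher's `Hint` operation for a negative mismatch:
if the most significant mismatching bit `j` of `x &&& m` against `p` has `p`'s bit equal
to `1`, then the least key `y > x` matching the pattern is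
`2^{j+1}·⌊x/2^{j+1}⌋ + 2^j + (p mod 2^j)`, and it is below `2^n`. -/
theorem point_hint_negative_mismatch (n m p x j : ℕ) (hn : 1 ≤ n) (hm : m < 2 ^ n)
    (hp : p &&& m = p) (hx : x < 2 ^ n) (hne : x &&& m ≠ p)
    (hj : (x &&& m).testBit j ≠ p.testBit j ∧
      ∀ i, j < i → (x &&& m).testBit i = p.testBit i)
    (hpj : p.testBit j = true) :
    IsLeast {y : ℕ | x < y ∧ y &&& m = p}
      (2 ^ (j + 1) * (x / 2 ^ (j + 1)) + 2 ^ j + p % 2 ^ j) ∧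
    2 ^ (j + 1) * (x / 2 ^ (j + 1)) + 2 ^ j + p % 2 ^ j < 2 ^ n := by
  have hpm : ∀ i, p.testBit i = true → m.testBit i = true := fun i hi => by
    have h := congrArg (fun k => k.testBit i) hp
    simpa [Nat.testBit_and, hi] using h
  have hxj : x.testBit j = false := by
    have h := hj.1
    simpa [Nat.testBit_and, hpj, hpm j hpj] using h
  have hpn : p < 2 ^ n := hp ▸ lt_of_le_of_lt Nat.and_le_right hm
  refine ⟨⟨⟨?_, ?_⟩, ?_⟩, ?_⟩
  · refine Nat.lt_of_testBit j hxj ?_ fun i hi => ?_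
    · simp [testBit_splice]
    · rw [testBit_splice, if_neg (by omega), if_neg (by omega)]
  · refine Nat.eq_of_testBit_eq fun i => ?_
    rw [Nat.testBit_and, testBit_splice]
    split_ifs with h1 h2
    · rw [← Nat.testBit_and, hp]
    · subst h2
      simp [hpj, hpm i hpj]
    · rw [← Nat.testBit_and]
      exact hj.2 i (by omega)
  · rintro y ⟨hxy, hy⟩
    have hpy : ∀ i, p.testBit i = true → y.testBit i = true := fun i hi => by
      rw [← hy, Nat.testBit_and, Bool.and_eq_true] at hi
      exact hi.1
    rcases (Nat.div_le_div_right (c := 2 ^ (j + 1)) hxy.le).lt_or_eq with hlt | heq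
    · have h1 : 2 ^ (j + 1) * (x / 2 ^ (j + 1) + 1) ≤ 2 ^ (j + 1) * (y / 2 ^ (j + 1)) :=
        Nat.mul_le_mul_left _ hlt
      have h2 := Nat.mul_div_le y (2 ^ (j + 1))
      have h3 : p % 2 ^ j < 2 ^ j := Nat.mod_lt _ (by positivity)
      have h4 : 2 ^ (j + 1) = 2 ^ j + 2 ^ j := by ring
      rw [Nat.mul_add, Nat.mul_one] at h1
      omega
    · rw [heq]
      have hand : (2 ^ (j + 1) * (y / 2 ^ (j + 1)) + 2 ^ j + p % 2 ^ j) &&& y =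
          2 ^ (j + 1) * (y / 2 ^ (j + 1)) + 2 ^ j + p % 2 ^ j := by
        refine Nat.eq_of_testBit_eq fun i => ?_
        rw [Nat.testBit_and, testBit_splice]
        split_ifs with h1 h2
        · have h := hpy i
          cases hpi : p.testBit i <;> simp_all
        · subst h2
          simp [hpy i hpj]
        · simp
      rw [← hand]
      exact Nat.and_le_right
  · refine Nat.lt_pow_two_of_testBit _ fun i hi => ?_
    have hpi := Nat.testBit_lt_two_pow (hpn.trans_le (Nat.pow_le_pow_right two_pos hi))
    have hxi := Nat.testBit_lt_two_pow (hx.trans_le (Nat.pow_le_pow_right two_pos hi))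
    rw [testBit_splice]
    split_ifs with h1 h2
    · exact hpi
    · subst h2
      simp [hpj] at hpi
    · exact hxi
end

section
/- Let n, t, d be natural numbers with 1 ≤ d ≤ n and t ≤ n, and set N = 2^{n−t} and P̄ = 2^{−(n−t)}. Let P_1, …, P_N be nonnegative reals with Σ P_i = 1, and let σ² = (1/N)·Σ (P_i − P̄)². Let k_1, …, k_N be natural numbers with k_i ≤ 2^d − 1 for all i and Σ k_i ≤ 2^{n−t}·(1 − 2^{d−n})·(2^d − 1). Then for every ε > 0: Σ k_i P_i / (2^d − 1) ≤ (1+ε)·(1 − 2^{d−n}) + 2^{3(n−t)}·σ²/ε². -/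
/-- Chebyshev-type pointwise bound: a number `p ≤ 1` either is at most `(1 + ε) * a`, or its
squared deviation from `a`, in units of `ε * a`, is at least `1`. -/
theorem le_one_add_mul_add_sq_div {p a ε : ℝ} (hp : p ≤ 1) (ha : 0 < a) (hε : 0 < ε) :
    p ≤ (1 + ε) * a + (p - a) ^ 2 / (ε * a) ^ 2 := by
  have hεa : 0 < ε * a := mul_pos hε ha
  rcases le_or_gt p ((1 + ε) * a) with h | h
  · have : 0 ≤ (p - a) ^ 2 / (ε * a) ^ 2 := by positivity
    linarith
  · have h1 : 1 ≤ (p - a) ^ 2 / (ε * a) ^ 2 := by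
      rw [one_le_div (by positivity)]
      exact pow_le_pow_left₀ hεa.le (by linarith) 2
    have : 0 ≤ (1 + ε) * a := by positivity
    linarith

/-- A weighted sum of probabilities, with weights in `[0, 1]`, is controlled by the total weight
and the squared deviation of the probabilities from a reference value `a`. -/
theorem sum_mul_le_of_weights_le_one {ι : Type*} [Fintype ι] {w P : ι → ℝ} {a ε : ℝ}
    (hw0 : ∀ i, 0 ≤ w i) (hw1 : ∀ i, w i ≤ 1) (hP : ∀ i, P i ≤ 1) (ha : 0 < a) (hε : 0 < ε) :
    ∑ i, w i * P i ≤
      (1 + ε) * a * ∑ i, w i + (∑ i, (P i - a) ^ 2) / (ε * a) ^ 2 := by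
  rw [Finset.mul_sum, Finset.sum_div, ← Finset.sum_add_distrib]
  refine Finset.sum_le_sum fun i _ => ?_
  have hq : 0 ≤ (P i - a) ^ 2 / (ε * a) ^ 2 := by positivity
  calc w i * P i ≤ w i * ((1 + ε) * a + (P i - a) ^ 2 / (ε * a) ^ 2) :=
        mul_le_mul_of_nonneg_left (le_one_add_mul_add_sq_div (hP i) ha hε) (hw0 i)
    _ ≤ (1 + ε) * a * w i + (P i - a) ^ 2 / (ε * a) ^ 2 := by
        linarith [mul_le_of_le_one_left hq (hw1 i)]

/-- Estimate (5) of the paper: with `P` a probability distribution over the `2^(n-t)`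
fundamental regions with mean `P̄ = 2^{-(n-t)}` and variance `σ²`, and co-frequencies
`k_i ≤ 2^d - 1` with `Σ k_i ≤ 2^{n-t}(1 - 2^{d-n})(2^d - 1)`, one has, for every `ε > 0`,
`Σ k_i P_i / (2^d - 1) ≤ (1+ε)(1 - 2^{d-n}) + 2^{3(n-t)}σ²/ε²`. -/
theorem cofrequency_sum_estimate (n t d : ℕ) (hd1 : 1 ≤ d) (hdn : d ≤ n) (ht : t ≤ n)
    (P : Fin (2 ^ (n - t)) → ℝ) (hP : ∀ i, 0 ≤ P i) (hPsum : ∑ i, P i = 1)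
    (σ2 : ℝ)
    (hσ : σ2 = (1 / (2 ^ (n - t) : ℝ)) * ∑ i, (P i - ((2 ^ (n - t) : ℝ))⁻¹) ^ 2)
    (k : Fin (2 ^ (n - t)) → ℕ) (hk : ∀ i, k i ≤ 2 ^ d - 1)
    (hksum : (∑ i, (k i : ℝ)) ≤
      (2 ^ (n - t) : ℝ) * (1 - (2 : ℝ) ^ ((d : ℤ) - (n : ℤ))) * ((2 : ℝ) ^ d - 1)) :
    ∀ ε : ℝ, 0 < ε →
      (∑ i, (k i : ℝ) * P i) / ((2 : ℝ) ^ d - 1) ≤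
        (1 + ε) * (1 - (2 : ℝ) ^ ((d : ℤ) - (n : ℤ))) +
          (2 : ℝ) ^ (3 * (n - t)) * σ2 / ε ^ 2 := by
  intro ε hε
  have hD : (0 : ℝ) < 2 ^ d - 1 := sub_pos.2 (one_lt_pow₀ one_lt_two (by omega))
  have hN : (0 : ℝ) < 2 ^ (n - t) := by positivity
  have hkD (i) : (k i : ℝ) ≤ 2 ^ d - 1 := by
    have h1 := hk i
    have h2 : k i + 1 ≤ 2 ^ d := by have := Nat.one_le_two_pow (n := d); omega
    have h3 : (k i : ℝ) + 1 ≤ 2 ^ d := by exact_mod_cast h2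
    linarith
  have hP1 (i) : P i ≤ 1 :=
    hPsum ▸ Finset.single_le_sum (fun j _ => hP j) (Finset.mem_univ i)
  have key := sum_mul_le_of_weights_le_one (w := fun i => (k i : ℝ) / (2 ^ d - 1))
    (fun i => div_nonneg (k i).cast_nonneg hD.le) (fun i => (div_le_one hD).2 (hkD i))
    hP1 (inv_pos.2 hN) hε
  have hlhs : (∑ i, (k i : ℝ) * P i) / ((2 : ℝ) ^ d - 1) =
      ∑ i, (k i : ℝ) / (2 ^ d - 1) * P i := by
    rw [Finset.sum_div]
    exact Finset.sum_congr rfl fun i _ => by ring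
  rw [hlhs]
  refine key.trans (add_le_add ?_ (le_of_eq ?_))
  · rw [mul_assoc, ← Finset.sum_div]
    refine mul_le_mul_of_nonneg_left ?_ (by positivity)
    rwa [inv_mul_le_iff₀ hN, div_le_iff₀ hD]
  · rw [hσ, mul_comm 3, pow_mul]
    generalize ∑ i, (P i - ((2 ^ (n - t) : ℝ))⁻¹) ^ 2 = S
    field_simp
end

section
/- Let n ≥ 1 and let m < 2^n be a mask with popcount d, 1 ≤ d ≤ n. Then 2^d·(2^n − m − 2^{n−d}) ≤ (2^n − 2^d)·(2^d − 1), with equality when m = 2^d − 1. (Equivalently, the total lacunae length 2^n − m − 2^{n−d} of a point PSP with mask m is at most 2^n·(1 − 2^{d−n})·(1 − 2^{−d}), the maximum being attained for the contiguous tailless mask.) -/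
theorem two_pow_card_filter_testBit_le (n m : ℕ) :
    2 ^ ((Finset.range n).filter (fun i => m.testBit i)).card ≤ m + 1 := by
  induction n generalizing m with
  | zero => simp
  | succ n ih =>
    have h := ih (m / 2)
    rw [Finset.card_filter] at h ⊢
    rw [Finset.sum_range_succ']
    simp only [Nat.testBit_succ, Nat.testBit_zero, decide_eq_true_eq]
    rw [pow_add]
    split_ifs with h0
    · rw [pow_one]
      omega
    · rw [pow_zero, mul_one]
      omega


/-- The total lacunae length `2^n - m - 2^{n-d}` of a point PSP with mask `m` satisfies
`2^d·(2^n - m - 2^{n-d}) ≤ (2^n - 2^d)·(2^d - 1)`, with equality when `m = 2^d - 1`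
(the contiguous tailless mask). -/
theorem total_lacunae_length_bound (n m d : ℕ) (hn : 1 ≤ n) (hm : m < 2 ^ n)
    (hd : d = ((Finset.range n).filter (fun i => m.testBit i)).card)
    (hd1 : 1 ≤ d) (hdn : d ≤ n) :
    2 ^ d * (2 ^ n - m - 2 ^ (n - d)) ≤ (2 ^ n - 2 ^ d) * (2 ^ d - 1) ∧
    (m = 2 ^ d - 1 →
      2 ^ d * (2 ^ n - m - 2 ^ (n - d)) = (2 ^ n - 2 ^ d) * (2 ^ d - 1)) := by
  obtain ⟨k, rfl⟩ := Nat.exists_eq_add_of_le hdn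
  have hle : 2 ^ d ≤ m + 1 := hd ▸ two_pow_card_filter_testBit_le (d + k) m
  have key : 2 ^ d * (2 ^ (d + k) - (2 ^ d - 1) - 2 ^ (d + k - d)) =
      (2 ^ (d + k) - 2 ^ d) * (2 ^ d - 1) := by
    rw [Nat.add_sub_cancel_left, pow_add]
    obtain ⟨a, ha⟩ := Nat.exists_eq_add_of_le' (Nat.one_le_two_pow (n := d))
    obtain ⟨b, hb⟩ := Nat.exists_eq_add_of_le' (Nat.one_le_two_pow (n := k))
    rw [ha, hb]
    have h₁ : (a + 1) * (b + 1) - (a + 1 - 1) - (b + 1) = a * b := by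
      rw [show (a + 1) * (b + 1) = a * b + a + b + 1 by ring]
      omega
    have h₂ : (a + 1) * (b + 1) - (a + 1) = (a + 1) * b := by
      rw [mul_add_one, Nat.add_sub_cancel]
    rw [h₁, h₂, Nat.add_sub_cancel]
    ring
  refine ⟨key ▸ Nat.mul_le_mul_left _ (by omega), ?_⟩
  rintro rfl
  exact key
end

section
/- Let n ≥ 1, let m < 2^n be a mask, and let a < b be patterns for m. Let j be the most significant bit position at which a and b differ, and set m_hi = 2^{j+1}·⌊m/2^{j+1}⌋ and m_lo = m mod 2^{j+1}. Then a &&& m_hi = b &&& m_hi, and for every x < 2^n: (a ≤ x &&& m ∧ x &&& m ≤ b) if and only if (x &&& m_hi = a &&& m_hi ∧ a mod 2^{j+1} ≤ x &&& m_lo ∧ x &&& m_lo ≤ b mod 2^{j+1}). (Factorization of a range PSP into a point PSP on the common-prefix mask and a range PSP on the suffix mask.) -/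
theorem Nat.land_two_pow_mul_div (x m k : ℕ) :
    x &&& (2 ^ k * (m / 2 ^ k)) = 2 ^ k * ((x &&& m) / 2 ^ k) := by
  apply Nat.eq_of_testBit_eq
  intro i
  simp only [Nat.testBit_and, Nat.testBit_two_pow_mul, Nat.testBit_div_two_pow]
  by_cases h : k ≤ i <;> simp [h]

theorem Nat.land_mod_two_pow_right (x m k : ℕ) :
    x &&& (m % 2 ^ k) = (x &&& m) % 2 ^ k := by
  apply Nat.eq_of_testBit_eq
  intro i
  simp only [Nat.testBit_and, Nat.testBit_mod_two_pow]
  exact Bool.and_left_comm _ _ _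

theorem Nat.le_and_le_iff_of_div_eq {a b q : ℕ} (y : ℕ) (h : a / q = b / q) :
    (a ≤ y ∧ y ≤ b) ↔ (q * (y / q) = q * (a / q) ∧ a % q ≤ y % q ∧ y % q ≤ b % q) := by
  have hA := Nat.div_add_mod a q
  have hB := Nat.div_add_mod b q
  have hY := Nat.div_add_mod y q
  constructor
  · rintro ⟨h₁, h₂⟩
    have e : y / q = a / q :=
      le_antisymm (h ▸ Nat.div_le_div_right h₂) (Nat.div_le_div_right h₁)
    rw [e] at hY
    rw [← h] at hB
    exact ⟨by rw [e], by omega, by omega⟩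
  · rintro ⟨e, h₁, h₂⟩
    rw [← h] at hB
    exact ⟨by omega, by omega⟩

/-- Factorization of a range PSP into a point PSP on the common-prefix mask and a range
PSP on the suffix mask: with `j` the most significant bit at which `a` and `b` differ,
`m_hi = 2^{j+1}·⌊m/2^{j+1}⌋` and `m_lo = m mod 2^{j+1}`, we have
`a &&& m_hi = b &&& m_hi`, and `a ≤ x &&& m ≤ b` iff `x` matches `a`'s prefix on `m_hi`
and `a mod 2^{j+1} ≤ x &&& m_lo ≤ b mod 2^{j+1}`. -/
theorem range_psp_prefix_factorization (n m a b j : ℕ) (hn : 1 ≤ n) (hm : m < 2 ^ n)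
    (ha : a &&& m = a) (hb : b &&& m = b) (hab : a < b)
    (hj : a.testBit j ≠ b.testBit j ∧ ∀ i, j < i → a.testBit i = b.testBit i) :
    a &&& (2 ^ (j + 1) * (m / 2 ^ (j + 1))) = b &&& (2 ^ (j + 1) * (m / 2 ^ (j + 1))) ∧
    ∀ x : ℕ, x < 2 ^ n →
      ((a ≤ x &&& m ∧ x &&& m ≤ b) ↔
        (x &&& (2 ^ (j + 1) * (m / 2 ^ (j + 1))) =
            a &&& (2 ^ (j + 1) * (m / 2 ^ (j + 1))) ∧
          a % 2 ^ (j + 1) ≤ x &&& (m % 2 ^ (j + 1)) ∧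
          x &&& (m % 2 ^ (j + 1)) ≤ b % 2 ^ (j + 1))) := by
  have hdiv : a / 2 ^ (j + 1) = b / 2 ^ (j + 1) := by
    apply Nat.eq_of_testBit_eq
    intro i
    simp only [Nat.testBit_div_two_pow]
    exact hj.2 _ (by omega)
  simp only [Nat.land_two_pow_mul_div, Nat.land_mod_two_pow_right, ha, hb]
  exact ⟨by rw [hdiv], fun x _ => Nat.le_and_le_iff_of_div_eq _ hdiv⟩
end
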